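/- Let G be a finite group with a nilpotent maximal subgroup of odd order. Then G is solvable. -/

import Mathlib

universe u

/-- A group is `p`-nilpotent if it has a normal `p`-complement. -/
def IsPNilpotent (p : ℕ) (G : Type*) [Group G] : Prop :=
  ∃ N : Subgroup G, N.Normal ∧ (Nat.card N).Coprime p ∧ ∀ g : G, ∃ k, g ^ p ^ k ∈ N

section PNilpotent

variable {p : ℕ} {G H : Type*} [Group G] [Group H]

lemma orderOf_coprime_of_mem {N : Subgroup G} (hN : (Nat.card N).Coprime p) {x : G} (hx : x ∈ N) :
    (orderOf x).Coprime p :=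
  Nat.Coprime.coprime_dvd_left (Subgroup.orderOf_dvd_natCard N hx) hN

lemma mem_of_pow_mem_of_coprime {N : Subgroup G} {x : G} {n : ℕ} (hx : (orderOf x).Coprime n)
    (h : x ^ n ∈ N) : x ∈ N := by
  obtain ⟨m, hm⟩ := exists_pow_eq_self_of_coprime hx.symm
  exact hm ▸ N.pow_mem h m

lemma mem_iff_orderOf_coprime [Finite G] {N : Subgroup G} (hN : (Nat.card N).Coprime p)
    (h : ∀ g : G, ∃ k, g ^ p ^ k ∈ N) (x : G) : x ∈ N ↔ (orderOf x).Coprime p := by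
  refine ⟨orderOf_coprime_of_mem hN, fun hx ↦ ?_⟩
  obtain ⟨k, hk⟩ := h x
  exact mem_of_pow_mem_of_coprime (hx.pow_right k) hk

/-- In a finite group, any element has a `p`-power of order prime to `p`. -/
lemma exists_orderOf_pow_coprime [Finite G] (hp : p.Prime) (g : G) :
    ∃ k, (orderOf (g ^ p ^ k)).Coprime p := by
  obtain ⟨k, m, hm, h⟩ := Nat.exists_eq_pow_mul_and_not_dvd (orderOf_pos g).ne' p hp.ne_one
  refine ⟨k, ?_⟩
  rw [orderOf_pow_of_dvd (pow_ne_zero _ hp.ne_zero) (h ▸ dvd_mul_right _ _), h,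
    Nat.mul_div_cancel_left _ (pow_pos hp.pos _)]
  exact ((Nat.Prime.coprime_iff_not_dvd hp).2 hm).symm

lemma eq_bot_of_isPGroup_of_coprime [Finite G] {K : Subgroup G} (h : IsPGroup p K)
    (hK : (Nat.card K).Coprime p) : K = ⊥ := by
  rw [eq_bot_iff]
  intro x hx
  obtain ⟨k, hk⟩ := (isPGroup_iff_pow_pow_eq_one.1 h) ⟨x, hx⟩
  exact mem_of_pow_mem_of_coprime ((orderOf_coprime_of_mem hK hx).pow_right k)
    (by simpa using congrArg Subtype.val hk)

lemma IsPNilpotent.of_injective {f : H →* G} (hf : Function.Injective f)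
    (h : IsPNilpotent p G) : IsPNilpotent p H := by
  obtain ⟨N, hN, hc, hk⟩ := h
  refine ⟨N.comap f, hN.comap f, ?_, fun g ↦ ?_⟩
  · exact Nat.Coprime.coprime_dvd_left (Subgroup.card_comap_dvd_of_injective N f hf) hc
  · simpa using hk (f g)

lemma IsPNilpotent.of_surjective {f : G →* H} (hf : Function.Surjective f)
    (h : IsPNilpotent p G) : IsPNilpotent p H := by
  obtain ⟨N, hN, hc, hk⟩ := h
  refine ⟨N.map f, hN.map f hf, ?_, fun g ↦ ?_⟩
  · exact Nat.Coprime.coprime_dvd_left (Subgroup.card_map_dvd N f) hc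
  · obtain ⟨g, rfl⟩ := hf g
    obtain ⟨k, hk⟩ := hk g
    exact ⟨k, _, hk, by simp⟩

/-- The normal `p`-complement of a normal `p`-nilpotent subgroup is normal in the whole group. -/
lemma IsPNilpotent.exists_normal [Finite G] {K : Subgroup G} [K.Normal] (h : IsPNilpotent p K) :
    ∃ N : Subgroup G, N.Normal ∧ N ≤ K ∧ (Nat.card N).Coprime p ∧
      ∀ g ∈ K, ∃ k, g ^ p ^ k ∈ N := by
  obtain ⟨N, hN, hc, hk⟩ := h
  have hmem : ∀ x, x ∈ N.map K.subtype ↔ x ∈ K ∧ (orderOf x).Coprime p := by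
    intro x
    constructor
    · rintro ⟨y, hy, rfl⟩
      exact ⟨y.2, by simpa using (mem_iff_orderOf_coprime hc hk y).1 hy⟩
    · rintro ⟨hx, hx'⟩
      exact ⟨⟨x, hx⟩, (mem_iff_orderOf_coprime hc hk _).2 (by simpa using hx'), rfl⟩
  refine ⟨N.map K.subtype, ⟨fun x hx g ↦ ?_⟩, Subgroup.map_subtype_le N, ?_, fun g hg ↦ ?_⟩
  · rw [hmem] at hx ⊢
    refine ⟨‹K.Normal›.conj_mem _ hx.1 g, ?_⟩
    have := orderOf_injective (MulAut.conj g).toMonoidHom (MulAut.conj g).injective x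
    simp only [MulEquiv.coe_toMonoidHom, MulAut.conj_apply] at this
    rw [this]
    exact hx.2
  · rwa [Subgroup.card_map_of_injective K.subtype_injective]
  · obtain ⟨k, hk⟩ := hk ⟨g, hg⟩
    exact ⟨k, _, hk, rfl⟩

lemma IsPNilpotent.of_normal [Finite G] {K : Subgroup G} [K.Normal] (h : IsPNilpotent p K)
    (hK : ∀ g : G, ∃ k, g ^ p ^ k ∈ K) : IsPNilpotent p G := by
  obtain ⟨N, hN, -, hc, hk⟩ := h.exists_normal
  refine ⟨N, hN, hc, fun g ↦ ?_⟩
  obtain ⟨k, hg⟩ := hK g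
  obtain ⟨l, hl⟩ := hk _ hg
  exact ⟨k + l, by rwa [pow_add, pow_mul]⟩

lemma IsPNilpotent.of_quotient [Finite G] {K : Subgroup G} [K.Normal] (hK : (Nat.card K).Coprime p)
    (h : IsPNilpotent p (G ⧸ K)) : IsPNilpotent p G := by
  obtain ⟨N, hN, hc, hk⟩ := h
  refine ⟨N.comap (QuotientGroup.mk' K), hN.comap _, ?_, fun g ↦ ?_⟩
  · have : Nat.card (N.comap (QuotientGroup.mk' K)) = Nat.card K * Nat.card N := by
      have h1 := (N.comap (QuotientGroup.mk' K)).card_mul_index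
      rw [Subgroup.index_comap_of_surjective _ (QuotientGroup.mk'_surjective K),
        ← K.card_mul_index, Subgroup.index_eq_card K, ← N.card_mul_index, ← mul_assoc] at h1
      exact Nat.eq_of_mul_eq_mul_right (Nat.pos_of_ne_zero N.index_ne_zero_of_finite) h1
    rw [this]
    exact hK.mul_left hc
  · simpa using hk (QuotientGroup.mk' K g)

lemma IsPNilpotent.of_isPGroup (h : IsPGroup p G) : IsPNilpotent p G :=
  ⟨⊥, inferInstance, by simp, fun g ↦ by
    obtain ⟨k, hk⟩ := (isPGroup_iff_pow_pow_eq_one.1 h) g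
    exact ⟨k, by simpa using hk⟩⟩

lemma IsPNilpotent.of_isNilpotent [Finite G] [hp : Fact p.Prime] (h : Group.IsNilpotent G) :
    IsPNilpotent p G := by
  by_cases hpG : p ∈ (Nat.card G).primeFactors
  swap
  · refine ⟨⊤, inferInstance, ?_, fun g ↦ ⟨0, Subgroup.mem_top _⟩⟩
    rw [Subgroup.card_top, Nat.coprime_comm, hp.out.coprime_iff_not_dvd]
    exact fun h ↦ hpG (Nat.mem_primeFactors.2 ⟨hp.out, h, Nat.card_pos.ne'⟩)
  obtain ⟨e⟩ := (Group.isNilpotent_of_finite_tfae.out 0 4).1 h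
  obtain ⟨P⟩ : Nonempty (Sylow p G) := inferInstance
  let f : G →* P := ((Pi.evalMonoidHom _ P).comp (Pi.evalMonoidHom _ (⟨p, hpG⟩ :
    (Nat.card G).primeFactors))).comp e.symm.toMonoidHom
  have hf : Function.Surjective f :=
    (Function.surjective_eval (β := fun P : Sylow p G ↦ P) P).comp
      ((Function.surjective_eval (β := fun q : (Nat.card G).primeFactors ↦ ∀ P : Sylow q G, P)
        ⟨p, hpG⟩).comp e.symm.surjective)
  refine ⟨f.ker, inferInstance, ?_, fun g ↦ ?_⟩
  · have h1 : Nat.card f.ker * Nat.card P = P.index * Nat.card P := by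
      rw [mul_comm P.index, P.card_mul_index, ← f.ker.card_mul_index, Subgroup.index_ker,
        MonoidHom.range_eq_top_of_surjective f hf, Subgroup.card_top]
    rw [Nat.eq_of_mul_eq_mul_right Nat.card_pos h1, Nat.coprime_comm,
      hp.out.coprime_iff_not_dvd]
    exact P.not_dvd_index
  · obtain ⟨k, hk⟩ := (isPGroup_iff_pow_pow_eq_one.1 P.isPGroup') (f g)
    exact ⟨k, by simpa [MonoidHom.mem_ker] using hk⟩

/-- The normal `p`-complement centralizes every normal `p`-subgroup. -/
lemma commute_of_isPGroup_of_coprime [Finite G] {X N : Subgroup G} (hX : X.Normal) (hN : N.Normal)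
    (hXp : IsPGroup p X) (hNp : (Nat.card N).Coprime p) {x y : G} (hx : x ∈ X) (hy : y ∈ N) :
    Commute x y := by
  refine Subgroup.commute_of_normal_of_disjoint X N hX hN ?_ x y hx hy
  rw [disjoint_iff]
  exact eq_bot_of_isPGroup_of_coprime (hXp.to_le inf_le_left)
    (hNp.coprime_dvd_left (Subgroup.card_dvd_of_le inf_le_right))

end PNilpotent

section Frobenius

variable {p : ℕ} {G H : Type*} [Group G] [Group H]

open Subgroup
open scoped commutatorElement

lemma IsPNilpotent.normalizer_of_map {f : H →* G} (hf : Function.Injective f) {X : Subgroup H}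
    (h : IsPNilpotent p (normalizer (X.map f : Set G))) :
    IsPNilpotent p (normalizer (X : Set H)) := by
  refine h.of_injective (f := (f.comp (normalizer (X : Set H)).subtype).codRestrict _
    fun x ↦ le_normalizer_map f (mem_map_of_mem f x.2)) ?_
  intro x y hxy
  exact Subtype.ext (hf (congrArg Subtype.val hxy))

lemma isPGroup_quotient {N : Subgroup G} [N.Normal] (h : ∀ g : G, ∃ k, g ^ p ^ k ∈ N) :
    IsPGroup p (G ⧸ N) := by
  rw [isPGroup_iff_pow_pow_eq_one]
  intro g
  obtain ⟨g, rfl⟩ := QuotientGroup.mk_surjective g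
  obtain ⟨k, hk⟩ := h g
  exact ⟨k, by rwa [← QuotientGroup.mk_pow, QuotientGroup.eq_one_iff]⟩

lemma sup_sylow_eq_top [Finite G] [Fact p.Prime] {N : Subgroup G} [N.Normal]
    (h : ∀ g : G, ∃ k, g ^ p ^ k ∈ N) (P : Sylow p G) : N ⊔ P = ⊤ := by
  obtain ⟨n, hn⟩ := (IsPGroup.iff_card).1 (isPGroup_quotient h)
  rw [← index_eq_card] at hn
  rw [← index_eq_one]
  have h1 := index_dvd_of_le (le_sup_left : N ≤ N ⊔ P)
  have h2 := index_dvd_of_le (le_sup_right : (P : Subgroup G) ≤ N ⊔ P)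
  have h3 : (P : Subgroup G).index.Coprime (p ^ n) :=
    (((Fact.out : p.Prime).coprime_iff_not_dvd.2 P.not_dvd_index).pow_left n).symm
  exact Nat.eq_one_of_dvd_coprimes h3 h2 (hn ▸ h1)

/-- In a finite `p`-group normalizers grow. -/
lemma lt_normalizer_inf [Finite G] [Fact p.Prime] {D P : Subgroup G} (hP : IsPGroup p P)
    (h : D < P) : D < normalizer (D : Set G) ⊓ P := by
  refine lt_of_le_of_ne (le_inf le_normalizer h.le) fun heq ↦ ?_
  have hnil : Group.IsNilpotent P := hP.isNilpotent
  have h1 := Group.normalizerCondition_of_isNilpotent (G := P) (D.subgroupOf P)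
    (lt_top_iff_ne_top.2 fun h' ↦ h.not_ge (subgroupOf_eq_top.1 h'))
  refine h1.not_ge fun x hx ↦ ?_
  rw [mem_subgroupOf, heq]
  refine ⟨?_, x.2⟩
  have := le_normalizer_map P.subtype (mem_map_of_mem P.subtype hx)
  rwa [map_subgroupOf_eq_of_le h.le] at this

/-- If `X` is a `p`-subgroup with `p`-nilpotent normalizer, then every element of the normalizer
is the product of an element centralizing `X` and an element of a given Sylow subgroup. -/
lemma exists_centralizer_mul_sylow [Finite G] [Fact p.Prime] {X : Subgroup G} (hX : IsPGroup p X)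
    (h : IsPNilpotent p (normalizer (X : Set G))) (S : Sylow p (normalizer (X : Set G)))
    (g : normalizer (X : Set G)) :
    ∃ c : normalizer (X : Set G), (c : G) ∈ centralizer (X : Set G) ∧ ∃ s ∈ S, g = c * s := by
  obtain ⟨N, hN, hc, hk⟩ := h
  have hg : g ∈ N ⊔ S := sup_sylow_eq_top hk S ▸ mem_top g
  rw [← SetLike.mem_coe, normal_mul] at hg
  obtain ⟨c, hcN, s, hs, rfl⟩ := hg
  refine ⟨c, mem_centralizer_iff.2 fun x hx ↦ ?_, s, hs, rfl⟩
  have := commute_of_isPGroup_of_coprime (p := p)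
    (X := X.subgroupOf (normalizer (X : Set G))) inferInstance hN
    (hX.comap_of_injective _ (subtype_injective _)) hc (x := ⟨x, le_normalizer hx⟩) hx hcN
  exact congrArg Subtype.val this.eq

lemma exists_centralizer_smul_eq [Finite G] [Fact p.Prime] {X : Subgroup G} (hX : IsPGroup p X)
    (h : IsPNilpotent p (normalizer (X : Set G))) (S T : Sylow p (normalizer (X : Set G))) :
    ∃ c : normalizer (X : Set G), (c : G) ∈ centralizer (X : Set G) ∧ c • S = T := by
  obtain ⟨g, rfl⟩ := MulAction.exists_smul_eq (normalizer (X : Set G)) S T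
  obtain ⟨c, hc, s, hs, rfl⟩ := exists_centralizer_mul_sylow hX h S g
  refine ⟨c, hc, ?_⟩
  rw [mul_smul, Sylow.smul_eq_iff_mem_normalizer.2 (le_normalizer hs)]

lemma exists_centralizer_inf_smul_eq [Finite G] [Fact p.Prime]
    (hG : ∀ X : Subgroup G, IsPGroup p X → X ≠ ⊥ → IsPNilpotent p (normalizer (X : Set G)))
    (P Q : Sylow p G) :
    ∃ c ∈ centralizer ((P ⊓ Q : Subgroup G) : Set G), c • P = Q := by
  induction hn : Nat.card G - Nat.card (P ⊓ Q : Subgroup G) using Nat.strong_induction_on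
    generalizing P Q with
  | _ n ih =>
  subst hn
  set D : Subgroup G := P ⊓ Q with hD
  have key : ∀ P' Q' : Sylow p G, D < (P' ⊓ Q' : Subgroup G) →
      ∃ c ∈ centralizer (D : Set G), c • P' = Q' := by
    intro P' Q' h
    have h1 : Nat.card D < Nat.card (P' ⊓ Q' : Subgroup G) :=
      Set.Finite.card_lt_card (Set.toFinite _) h
    have h2 := card_le_card_group (P' ⊓ Q' : Subgroup G)
    obtain ⟨c, hc, h3⟩ := ih _ (by omega) P' Q' rfl
    exact ⟨c, centralizer_le h.le hc, h3⟩
  by_cases hbot : D = ⊥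
  · obtain ⟨c, hc⟩ := MulAction.exists_smul_eq G P Q
    exact ⟨c, by simp [hbot, mem_centralizer_iff], hc⟩
  by_cases hPQ : P = Q
  · exact ⟨1, one_mem _, by simp [hPQ]⟩
  have hDP : D < P := lt_of_le_of_ne inf_le_left fun h ↦
    hPQ (Sylow.ext (P.3 Q.2 (inf_eq_left.1 h)).symm)
  have hDQ : D < Q := lt_of_le_of_ne inf_le_right fun h ↦
    hPQ (Sylow.ext (Q.3 P.2 (inf_eq_right.1 h)))
  have hDp : IsPGroup p D := P.2.to_le inf_le_left
  set W := normalizer (D : Set G) with hW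
  obtain ⟨S, hS⟩ := (P.2.comap_of_injective W.subtype W.subtype_injective).exists_le_sylow
  obtain ⟨T, hT⟩ := (Q.2.comap_of_injective W.subtype W.subtype_injective).exists_le_sylow
  obtain ⟨c, hc, hcS⟩ := exists_centralizer_smul_eq hDp (hG D hDp hbot) S T
  obtain ⟨R, hR⟩ := (S.2.map W.subtype).exists_le_sylow
  obtain ⟨x, hx, hxR⟩ := key P R <| (lt_normalizer_inf P.2 hDP).trans_le fun g hg ↦
    ⟨hg.2, hR ⟨⟨g, hg.1⟩, hS hg.2, rfl⟩⟩
  obtain ⟨y, hy, hyQ⟩ := key ((c : G) • R) Q <| (lt_normalizer_inf Q.2 hDQ).trans_le fun g hg ↦ by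
    refine ⟨?_, hg.2⟩
    have h1 : (⟨g, hg.1⟩ : W) ∈ T := hT hg.2
    rw [← hcS] at h1
    obtain ⟨s, hs, hs'⟩ := h1
    exact ⟨s, hR ⟨s, hs, rfl⟩, congrArg Subtype.val hs'⟩
  exact ⟨y * c * x, mul_mem (mul_mem hy hc) hx, by rw [mul_smul, mul_smul, hxR, hyQ]⟩

lemma focalSubgroup_le_commutator_self [Finite G] [Fact p.Prime]
    (hG : ∀ X : Subgroup G, IsPGroup p X → X ≠ ⊥ → IsPNilpotent p (normalizer (X : Set G)))
    (P : Sylow p G) (hP : (P : Subgroup G) ≠ ⊥) :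
    (P : Subgroup G).focalSubgroup ≤ ⁅(P : Subgroup G), (P : Subgroup G)⁆ := by
  rw [focalSubgroup_def, closure_le]
  rintro _ ⟨hg, x, hx, u, rfl⟩
  have hz : u * x * u⁻¹ ∈ (P : Subgroup G) := by
    have := inv_mem (mul_mem (inv_mem hx) hg)
    simpa [commutatorElement_def, mul_assoc] using this
  obtain ⟨c, hc, hcP⟩ := exists_centralizer_inf_smul_eq hG (u • P) P
  have hcz := mem_centralizer_iff.1 hc (u * x * u⁻¹) ⟨⟨x, hx, rfl⟩, hz⟩
  rw [← mul_smul, Sylow.smul_eq_iff_mem_normalizer] at hcP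
  obtain ⟨d, hd, s, hs, hds⟩ := exists_centralizer_mul_sylow P.2 (hG P P.2 hP)
    (P.subtype le_normalizer) ⟨c * u, hcP⟩
  have hsP : (s : G) ∈ P := hs
  have hds' : c * u = d * s := congrArg Subtype.val hds
  have hdx := mem_centralizer_iff.1 hd ((s : G) * x * (s : G)⁻¹)
    (mul_mem (mul_mem hsP hx) (inv_mem hsP))
  have h1 : u * x * u⁻¹ = s * x * (s : G)⁻¹ := by
    have h2 : u * x * u⁻¹ = (c * u) * x * (c * u)⁻¹ := by
      rw [eq_mul_inv_of_mul_eq hcz]; group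
    rw [h2, hds', eq_mul_inv_of_mul_eq hdx]; group
  have h2 : ⁅x, u⁆ = ⁅x, (s : G)⁆ := by
    rw [commutatorElement_def, commutatorElement_def]
    have h3 := congrArg (fun z ↦ x * z⁻¹) h1
    simpa [mul_assoc] using h3
  rw [h2]
  exact commutator_mem_commutator hx hsP

/-- **Frobenius' theorem**: a finite group all of whose nontrivial `p`-subgroups have `p`-nilpotent
normalizers is `p`-nilpotent. -/
theorem IsPNilpotent.of_normalizers [Fact p.Prime] {G : Type u} [Group G] [Finite G]
    (hG : ∀ X : Subgroup G, IsPGroup p X → X ≠ ⊥ → IsPNilpotent p (normalizer (X : Set G))) :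
    IsPNilpotent p G := by
  induction hn : Nat.card G using Nat.strong_induction_on generalizing G with
  | _ n ih =>
  subst hn
  obtain ⟨P⟩ : Nonempty (Sylow p G) := inferInstance
  by_cases hP : (P : Subgroup G) = ⊥
  · refine ⟨⊤, inferInstance, ?_, fun g ↦ ⟨0, mem_top _⟩⟩
    rw [card_top, Nat.coprime_comm, (Fact.out : p.Prime).coprime_iff_not_dvd]
    exact fun h ↦ P.ne_bot_of_dvd_card h hP
  set K := (P : Subgroup G).transferFocal.ker with hK
  have hKtop : K ≠ ⊤ := by
    intro h
    have h1 := ker_transferFocal_inf_eq_focalSubgroup P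
    rw [← hK, h, top_inf_eq] at h1
    have h2 := focalSubgroup_le_commutator_self hG P hP
    rw [← h1] at h2
    have : Group.IsNilpotent P := P.2.isNilpotent
    have : Nontrivial P := (nontrivial_iff_ne_bot _).2 hP
    refine (Group.IsSolvable.commutator_lt_top_of_nontrivial P).not_ge fun x _ ↦ ?_
    rw [← map_subtype_commutator] at h2
    obtain ⟨y, hy, hyx⟩ := h2 x.2
    exact Subtype.ext hyx ▸ hy
  refine IsPNilpotent.of_normal (K := K) (ih _ ?_ ?_ rfl) fun g ↦ ?_
  · exact lt_of_le_of_ne (card_le_card_group K) fun h ↦ hKtop (eq_top_of_card_eq K h)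
  · intro X hX hX'
    exact (hG _ (hX.map K.subtype)
      (by rwa [Ne, map_eq_bot_iff_of_injective _ K.subtype_injective])).normalizer_of_map
      K.subtype_injective
  · obtain ⟨k, hk⟩ := (isPGroup_iff_pow_pow_eq_one.1
      (P.2.to_quotient (P : Subgroup G).focalSubgroupOf)) ((P : Subgroup G).transferFocal g)
    exact ⟨k, by rwa [hK, MonoidHom.mem_ker, map_pow]⟩

end Frobenius

section Puig

open Subgroup

variable {G H : Type*} [Group G] [Group H]

/-- The subgroup generated by the abelian subgroups of `S` which are normalized by `X`. -/
def puig (S X : Subgroup G) : Subgroup G :=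
  sSup {A | A ≤ S ∧ A ≤ centralizer (A : Set G) ∧ X ≤ normalizer (A : Set G)}

lemma le_puig {S X A : Subgroup G} (hS : A ≤ S) (hA : A ≤ centralizer (A : Set G))
    (hX : X ≤ normalizer (A : Set G)) : A ≤ puig S X :=
  le_sSup ⟨hS, hA, hX⟩

lemma puig_le_iff {S X Y : Subgroup G} : puig S X ≤ Y ↔ ∀ A ≤ S,
    A ≤ centralizer (A : Set G) → X ≤ normalizer (A : Set G) → A ≤ Y := by
  simp only [puig, sSup_le_iff, Set.mem_ofPred_eq, and_imp]

lemma puig_le (S X : Subgroup G) : puig S X ≤ S :=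
  puig_le_iff.2 fun _ h _ _ ↦ h

lemma puig_anti (S : Subgroup G) {X Y : Subgroup G} (h : X ≤ Y) : puig S Y ≤ puig S X :=
  puig_le_iff.2 fun _ h₁ h₂ h₃ ↦ le_puig h₁ h₂ (h.trans h₃)

/-- The limit of the even terms of the Puig series of `S`. -/
def puigEven (S : Subgroup G) : Subgroup G :=
  OrderHom.lfp ⟨fun X ↦ puig S (puig S X), fun _ _ h ↦ puig_anti S (puig_anti S h)⟩

/-- The limit of the odd terms of the Puig series of `S`. -/
def puigOdd (S : Subgroup G) : Subgroup G :=
  puig S (puigEven S)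

lemma puig_puigOdd (S : Subgroup G) : puig S (puigOdd S) = puigEven S :=
  OrderHom.map_lfp (⟨fun X ↦ puig S (puig S X), fun _ _ h ↦ puig_anti S (puig_anti S h)⟩ :
    Subgroup G →o Subgroup G)

lemma puigEven_le_of_puig_puig_le {S X : Subgroup G} (h : puig S (puig S X) ≤ X) :
    puigEven S ≤ X :=
  OrderHom.lfp_le _ h

lemma puigEven_le (S : Subgroup G) : puigEven S ≤ S :=
  puig_puigOdd S ▸ puig_le _ _

lemma le_puigEven {S A : Subgroup G} (hS : A ≤ S) (hA : A ≤ centralizer (A : Set G))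
    (hX : S ≤ normalizer (A : Set G)) : A ≤ puigEven S :=
  puig_puigOdd S ▸ le_puig hS hA ((puig_le _ _).trans hX)

lemma map_le_normalizer_map_iff {f : G →* H} (hf : Function.Injective f) {X A : Subgroup G} :
    X.map f ≤ normalizer (A.map f : Set H) ↔ X ≤ normalizer (A : Set G) := by
  refine ⟨fun h x hx ↦ mem_normalizer_iff.2 fun a ↦ ?_,
    fun h ↦ (map_mono h).trans (le_normalizer_map f)⟩
  have := mem_normalizer_iff.1 (h (mem_map_of_mem f hx)) (f a)
  rwa [← map_mul, ← map_inv, ← map_mul, mem_map_iff_mem hf, mem_map_iff_mem hf] at this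

lemma map_le_centralizer_map_iff {f : G →* H} (hf : Function.Injective f) {A : Subgroup G} :
    A.map f ≤ centralizer (A.map f : Set H) ↔ A ≤ centralizer (A : Set G) := by
  constructor
  · intro h x hx
    refine mem_centralizer_iff.2 fun y hy ↦ hf ?_
    have := mem_centralizer_iff.1 (h (mem_map_of_mem f hx)) (f y) (mem_map_of_mem f hy)
    simpa using this
  · rintro h _ ⟨x, hx, rfl⟩
    refine mem_centralizer_iff.2 ?_
    rintro _ ⟨y, hy, rfl⟩
    rw [← map_mul, ← map_mul, mem_centralizer_iff.1 (h hx) y hy]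

lemma map_puig {f : G →* H} (hf : Function.Injective f) (S X : Subgroup G) :
    (puig S X).map f = puig (S.map f) (X.map f) := by
  apply le_antisymm
  · rw [map_le_iff_le_comap, puig_le_iff]
    intro A hS hA hX
    rw [← map_le_iff_le_comap]
    exact le_puig (map_mono hS) ((map_le_centralizer_map_iff hf).2 hA)
      ((map_le_normalizer_map_iff hf).2 hX)
  · rw [puig_le_iff]
    intro A hS hA hX
    obtain ⟨B, rfl⟩ : ∃ B : Subgroup G, B.map f = A :=
      ⟨A.comap f, map_comap_eq_self (hS.trans (map_le_range f S))⟩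
    exact map_mono (le_puig ((map_le_map_iff_of_injective hf).1 hS)
      ((map_le_centralizer_map_iff hf).1 hA) ((map_le_normalizer_map_iff hf).1 hX))

lemma map_puigEven {f : G →* H} (hf : Function.Injective f) (S : Subgroup G) :
    (puigEven S).map f = puigEven (S.map f) := by
  apply le_antisymm
  · obtain ⟨B, hB⟩ : ∃ B : Subgroup G, B.map f = puigEven (S.map f) :=
      ⟨_, map_comap_eq_self ((puigEven_le _).trans (map_le_range f S))⟩
    rw [← hB, map_le_map_iff_of_injective hf]
    refine puigEven_le_of_puig_puig_le ?_
    rw [← map_le_map_iff_of_injective hf, map_puig hf, map_puig hf, hB]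
    exact (puig_puigOdd _).le
  · refine puigEven_le_of_puig_puig_le ?_
    rw [← map_puig hf, ← map_puig hf]
    exact map_mono (puig_puigOdd _).le

instance puigEven_top_characteristic : (puigEven (⊤ : Subgroup G)).Characteristic := by
  rw [characteristic_iff_map_eq]
  intro φ
  rw [map_puigEven φ.injective, map_top_of_surjective _ φ.surjective]

lemma puigEven_normal {S : Subgroup G} (hS : S.Normal) : (puigEven S).Normal := by
  refine ⟨fun x hx g ↦ ?_⟩
  have h : S.map (MulAut.conj g).toMonoidHom = S := hS.conjAct g
  rw [← h, ← map_puigEven (MulAut.conj g).injective]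
  exact mem_map_of_mem _ hx

lemma puigEven_eq_of_puigOdd_le {S T : Subgroup G} (h : puigOdd S ≤ T) (hTS : T ≤ S) :
    puigEven T = puigEven S := by
  have hmono : ∀ X, puig T X ≤ puig S X := fun X ↦
    puig_le_iff.2 fun A h₁ h₂ h₃ ↦ le_puig (h₁.trans hTS) h₂ h₃
  have hE : puigEven S ≤ T := by
    refine le_trans ?_ h
    exact puigEven_le_of_puig_puig_le (by rw [puig_puigOdd]; rfl)
  have hO : puig T (puigEven S) = puigOdd S :=
    (hmono _).antisymm (puig_le_iff.2 fun A h₁ h₂ h₃ ↦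
      le_puig ((le_puig h₁ h₂ h₃).trans h) h₂ h₃)
  have hEO : puig T (puigOdd S) = puigEven S := by
    refine le_antisymm ((hmono _).trans (puig_puigOdd S).le) ?_
    conv_lhs => rw [← puig_puigOdd S]
    exact puig_le_iff.2 fun A h₁ h₂ h₃ ↦
      le_puig (((le_puig h₁ h₂ h₃).trans (puig_puigOdd S).le).trans hE) h₂ h₃
  have hle : puigEven T ≤ puigEven S := puigEven_le_of_puig_puig_le (by rw [hO, hEO])
  refine hle.antisymm (puigEven_le_of_puig_puig_le (puig_le_iff.2 fun A h₁ h₂ h₃ ↦ ?_))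
  have hA : A ≤ T :=
    ((le_puig h₁ h₂ ((puig_anti S hle).trans h₃)).trans (puig_puigOdd S).le).trans hE
  exact (le_puig hA h₂ ((hmono _).trans h₃)).trans (puig_puigOdd T).le

end Puig

section Quadratic

open Subgroup
open scoped commutatorElement IsMulCommutative

lemma eq_one_of_sub_one_pow_eq_zero {R : Type*} [Ring R] {w : R} {k m : ℕ} (hk : (w - 1) ^ k = 0)
    (hm : w ^ m = 1) (h : ∀ r : R, m * r = 0 → r = 0) : w = 1 := by
  have hpow : ∀ j, (w - 1) ^ (j + 2) = 0 → ∀ i : ℕ,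
      w ^ i * (w - 1) ^ j = (w - 1) ^ j + i * (w - 1) ^ (j + 1) := by
    intro j hj i
    have hw : w * (w - 1) ^ (j + 1) = (w - 1) ^ (j + 1) := by
      rw [← sub_eq_zero, ← sub_one_mul, ← pow_succ', hj]
    induction i with
    | zero => simp
    | succ i ih =>
      rw [pow_succ', mul_assoc, ih, mul_add, ← mul_assoc, ← Nat.cast_comm, mul_assoc, hw,
        Nat.cast_succ, add_mul, one_mul, pow_succ']
      noncomm_ring
  rw [← sub_eq_zero]
  induction k with
  | zero =>
    have := congrArg (· * (w - 1)) hk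
    simpa using this
  | succ k ih =>
    cases k with
    | zero => simpa using hk
    | succ k =>
      refine ih (h _ ?_)
      have := hpow k hk m
      rwa [hm, one_mul, left_eq_add] at this

lemma sub_one_pow_four_eq_zero {R : Type*} [Ring R] (h2 : ∀ r : R, 2 * r = 0 → r = 0) {α β : R}
    (hα : α * α = 0) (hβ : β * β = 0)
    (h : Commute ((1 - α) * (1 + β)) ((1 + β) * (1 - α))) :
    ((1 - α) * (1 + β) - 1) ^ 4 = 0 := by
  have h1 : α * β * α = - (β * α * β) := by
    rw [← sub_eq_zero]
    refine h2 _ ?_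
    linear_combination (norm := noncomm_ring) h.eq - (1 - α) * hβ * (1 - α) +
      (1 + β) * hα * (1 + β) - hα + hβ
  have h3 : α * β * α * β = 0 := by
    linear_combination (norm := noncomm_ring) h1 * β - β * α * hβ
  have h4 : β * α * β * α = 0 := by
    linear_combination (norm := noncomm_ring) h1 * α - α * β * hα
  have h5 : ((1 - α) * (1 + β) - 1) ^ 2 = α * β * α - α * β - β * α - β * α * β := by
    linear_combination (norm := noncomm_ring) hα + hβ - α * hβ + hα * β + h3
  rw [pow_mul _ 2 2, h5]
  simp only [mul_assoc] at h3 h4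
  have h6 : ∀ r, α * (α * r) = 0 := fun r ↦ by rw [← mul_assoc, hα, zero_mul]
  have h7 : ∀ r, β * (β * r) = 0 := fun r ↦ by rw [← mul_assoc, hβ, zero_mul]
  simp [pow_two, mul_sub, sub_mul, mul_assoc, h3, h4, h6, h7]

lemma Units.eq_of_sub_one_sq_eq_zero {R : Type*} [Ring R] (h2 : ∀ r : R, 2 * r = 0 → r = 0)
    {a b : Rˣ} (ha : ((a : R) - 1) * (a - 1) = 0) (hb : ((b : R) - 1) * (b - 1) = 0)
    (h : Commute (a⁻¹ * b) (b * a⁻¹)) {m : ℕ} (hm : (a⁻¹ * b) ^ m = 1)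
    (hmr : ∀ r : R, m * r = 0 → r = 0) : a⁻¹ * b = 1 := by
  have hinv : ((a⁻¹ : Rˣ) : R) = 1 - ((a : R) - 1) := by
    rw [Units.inv_eq_of_mul_eq_one_right]
    linear_combination (norm := noncomm_ring) -ha
  have hab : ((a⁻¹ * b : Rˣ) : R) = (1 - ((a : R) - 1)) * (1 + ((b : R) - 1)) := by
    rw [Units.val_mul, hinv, add_sub_cancel]
  have hba : ((b * a⁻¹ : Rˣ) : R) = (1 + ((b : R) - 1)) * (1 - ((a : R) - 1)) := by
    rw [Units.val_mul, hinv, add_sub_cancel]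
  refine Units.ext (eq_one_of_sub_one_pow_eq_zero (k := 4) (m := m) ?_ ?_ hmr)
  · rw [hab]
    refine sub_one_pow_four_eq_zero h2 ha hb ?_
    rw [← hab, ← hba]
    exact congrArg Units.val h.eq
  · exact congrArg Units.val hm

/-- The conjugation action on an abelian normal subgroup. -/
def conjEnd {G : Type*} [Group G] (Y : Subgroup G) [Y.Normal] [IsMulCommutative Y] :
    G →* AddMonoid.End (Additive Y) where
  toFun g := MonoidHom.toAdditive (MulAut.conjNormal g : MulAut Y).toMonoidHom
  map_one' := by rw [map_one]; rfl
  map_mul' _ _ := by rw [map_mul]; rfl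

/-- Two elements acting quadratically on an abelian normal subgroup `Y` of odd order have the same
action on `Y`, if their quotient commutes with its conjugate and has order coprime to `|Y|`. -/
lemma inv_mul_mem_centralizer_of_quadratic {G : Type*} [Group G] {Y : Subgroup G} [Finite Y]
    [Y.Normal] [IsMulCommutative Y] (hodd : Odd (Nat.card Y)) {a b : G}
    (ha : ∀ v ∈ Y, ⁅a, ⁅a, v⁆⁆ = 1) (hb : ∀ v ∈ Y, ⁅b, ⁅b, v⁆⁆ = 1)
    (h : ⁅a⁻¹ * b, b * a⁻¹⁆ ∈ centralizer (Y : Set G)) {m : ℕ} (hm : m.Coprime (Nat.card Y))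
    (hab : (a⁻¹ * b) ^ m ∈ centralizer (Y : Set G)) : a⁻¹ * b ∈ centralizer (Y : Set G) := by
  have hker : ∀ g, (conjEnd Y).toHomUnits g = 1 ↔ g ∈ centralizer (Y : Set G) := by
    intro g
    rw [mem_centralizer_iff, Units.ext_iff]
    constructor
    · intro h v hv
      have := congrArg (fun w : Additive Y ↦ (w.toMul : G))
        (DFunLike.congr_fun h (Additive.ofMul ⟨v, hv⟩))
      exact (mul_inv_eq_iff_eq_mul.1 this).symm
    · intro h
      ext v : 1
      refine Additive.toMul.injective (Subtype.ext ?_)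
      exact mul_inv_eq_iff_eq_mul.2 (h _ v.toMul.2).symm
  have hquad : ∀ g, (∀ v ∈ Y, ⁅g, ⁅g, v⁆⁆ = 1) →
      (conjEnd Y g - 1) * (conjEnd Y g - 1) = 0 := by
    have hcomm : ∀ g (w : Y), (((conjEnd Y g - 1) (Additive.ofMul w)).toMul : G) = ⁅g, (w : G)⁆ :=
      fun g w ↦ div_eq_mul_inv (g * (w : G) * g⁻¹) (w : G)
    intro g hg
    ext v : 1
    refine Additive.toMul.injective (Subtype.ext ?_)
    have h1 := hcomm g ((conjEnd Y g - 1) v).toMul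
    have h2 := hcomm g v.toMul
    exact (h1.trans (congrArg (fun w ↦ ⁅g, w⁆) h2)).trans (hg _ v.toMul.2)
  have hcop : ∀ n : ℕ, n.Coprime (Nat.card Y) →
      ∀ r : AddMonoid.End (Additive Y), n * r = 0 → r = 0 := by
    intro n hn r hr
    ext v : 1
    have h1 : (r v).toMul ^ n = 1 := by
      have := DFunLike.congr_fun hr v
      rw [← nsmul_eq_mul] at this
      exact this
    refine Additive.toMul.injective ((Nat.Coprime.pow_left_bijective hn.symm).injective ?_)
    exact h1.trans (one_pow n).symm
  rw [← hker, map_mul, map_inv]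
  refine Units.eq_of_sub_one_sq_eq_zero (m := m) ?_ (hquad a ha) (hquad b hb) ?_ ?_ (hcop m hm)
  · exact_mod_cast hcop 2 (Nat.coprime_two_left.2 hodd)
  · rw [← commutatorElement_eq_one_iff_commute]
    simpa using (hker _).2 h
  · simpa using (hker _).2 hab

end Quadratic

section Coatom

open Subgroup

variable {G : Type*} [Group G]

/-- If every supplement of a normal subgroup `L` contains a conjugate of the maximal subgroup `M`,
and `M` intersects `L` trivially, then `L` is nilpotent. -/
lemma isNilpotent_of_isCoatom_of_supplement [Finite G] {L M : Subgroup G} [L.Normal]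
    (hM : IsCoatom M) (hML : M ⊓ L = ⊥)
    (h : ∀ T : Subgroup G, T ⊔ L = ⊤ → ∃ g : G, M.map (MulAut.conj g).toMonoidHom ≤ T) :
    Group.IsNilpotent L := by
  refine ((Group.isNilpotent_of_finite_tfae (G := L)).out 0 3 rfl rfl).2 fun q _ Q ↦ ?_
  suffices (Q.map L.subtype).Normal by
    have := this.comap L.subtype
    rwa [comap_map_eq_self_of_injective L.subtype_injective] at this
  obtain ⟨g, hg⟩ := h _ (Q.normalizer_sup_eq_top)
  have hc : IsCoatom (M.map (MulAut.conj g).toMonoidHom) :=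
    (OrderIso.isCoatom_iff (MulAut.conj g).mapSubgroup M).2 hM
  rw [← normalizer_eq_top_iff]
  by_contra hT
  have hQ := le_normalizer.trans_eq ((hc.le_iff.1 hg).resolve_left hT)
  have hbot : Q.map L.subtype = ⊥ := by
    have hL : L.map (MulAut.conj g).toMonoidHom = L := (inferInstance : L.Normal).conjAct g
    have h1 := map_inf M L (MulAut.conj g).toMonoidHom (MulAut.conj g).injective
    rw [hML, hL, Subgroup.map_bot] at h1
    rw [eq_bot_iff, h1]
    exact le_inf hQ (map_subtype_le _)
  refine hT ?_
  rw [hbot]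
  exact normalizer_eq_top _

end Coatom

section CharacteristicNormalizers

open Subgroup

variable {p : ℕ} {G H : Type*} [Group G] [Group H]

/-- Every nontrivial characteristic subgroup of `S` has a `p`-nilpotent normalizer in `G`. -/
def HasPNilpotentNormalizers (p : ℕ) (S : Subgroup G) : Prop :=
  ∀ K : Subgroup S, K.Characteristic → K ≠ ⊥ →
    IsPNilpotent p (normalizer (K.map S.subtype : Set G))

lemma Characteristic.map_equiv {K : Subgroup G} (hK : K.Characteristic) (e : G ≃* H) :
    (K.map e.toMonoidHom).Characteristic := by
  rw [characteristic_iff_map_le]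
  rintro φ _ ⟨_, ⟨x, hx, rfl⟩, rfl⟩
  refine ⟨e.symm (φ (e x)), ?_, by simp⟩
  rw [← characteristic_iff_map_eq.1 hK ((e.trans φ).trans e.symm)]
  exact ⟨x, hx, rfl⟩

lemma normalizer_le_normalizer_map_of_characteristic {S : Subgroup G} {K : Subgroup S}
    (hK : K.Characteristic) :
    normalizer (S : Set G) ≤ normalizer (K.map S.subtype : Set G) := by
  have key : ∀ g : normalizer (S : Set G), ∀ x ∈ K.map S.subtype,
      (g : G) * x * (g : G)⁻¹ ∈ K.map S.subtype := by
    rintro g _ ⟨x, hx, rfl⟩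
    refine ⟨S.normalizerMonoidHom g x, ?_, rfl⟩
    rw [← characteristic_iff_map_eq.1 hK (S.normalizerMonoidHom g)]
    exact mem_map_of_mem _ hx
  refine fun g hg ↦ mem_normalizer_iff.2 fun x ↦ ⟨key ⟨g, hg⟩ x, fun h ↦ ?_⟩
  have := key ⟨g, hg⟩⁻¹ _ h
  simpa [mul_assoc] using this

lemma map_subtype_map_equiv {f : G →* H} {S : Subgroup G} {T : Subgroup H} (e : S ≃* T)
    (he : ∀ s, (e s : H) = f s) (K : Subgroup S) :
    (K.map e.toMonoidHom).map T.subtype = (K.map S.subtype).map f := by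
  rw [map_map, map_map]
  congr 1
  ext s
  exact he s

/-- If `S` corresponds to a subgroup `T` under an injective homomorphism, then the condition
`HasPNilpotentNormalizers` can be transferred from `T` to `S`. -/
lemma HasPNilpotentNormalizers.of_map {f : G →* H} (hf : Function.Injective f) {S : Subgroup G}
    (h : HasPNilpotentNormalizers p (S.map f)) : HasPNilpotentNormalizers p S := by
  intro K hK hbot
  have := h _ (Characteristic.map_equiv hK (S.equivMapOfInjective f hf))
    (by rwa [Ne, map_eq_bot_iff_of_injective _ (S.equivMapOfInjective f hf).injective])
  rw [map_subtype_map_equiv (f := f) _ (fun s ↦ rfl)] at this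
  exact this.normalizer_of_map hf

lemma HasPNilpotentNormalizers.sylow [Finite G] [Fact p.Prime] {P : Sylow p G}
    (h : HasPNilpotentNormalizers p (P : Subgroup G)) (Q : Sylow p G) :
    HasPNilpotentNormalizers p (Q : Subgroup G) := by
  obtain ⟨g, rfl⟩ := MulAction.exists_smul_eq G Q P
  exact HasPNilpotentNormalizers.of_map (MulAut.conj g).injective h

/-- A minimal counterexample to the normal complement theorem has a nontrivial normal
`p`-subgroup. -/
lemma exists_normal_isPGroup_of_not_isPNilpotent [Fact p.Prime] {G : Type u} [Group G] [Finite G]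
    {P : Sylow p G} (hP : HasPNilpotentNormalizers p (P : Subgroup G))
    (ih : ∀ N : Subgroup G, N ≠ ⊤ → ∀ S : Sylow p N,
      HasPNilpotentNormalizers p (S : Subgroup N) → IsPNilpotent p N)
    (hG : ¬ IsPNilpotent p G) : ∃ X : Subgroup G, X.Normal ∧ IsPGroup p X ∧ X ≠ ⊥ := by
  let s : Set (Subgroup G) :=
    {X | IsPGroup p X ∧ X ≠ ⊥ ∧ ¬ IsPNilpotent p (normalizer (X : Set G))}
  have hs : s.Nonempty := by
    by_contra h
    refine hG (IsPNilpotent.of_normalizers fun X h1 h2 ↦ ?_)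
    by_contra h3
    exact h ⟨X, h1, h2, h3⟩
  obtain ⟨X, ⟨hXp, hX, hXN⟩, hmax⟩ := s.toFinite.exists_maximalFor
    (fun X : Subgroup G ↦ (Nat.card (normalizer (X : Set G))).factorization p) s hs
  refine ⟨X, ?_, hXp, hX⟩
  rw [← normalizer_eq_top_iff]
  by_contra htop
  set N := normalizer (X : Set G)
  obtain ⟨S⟩ : Nonempty (Sylow p N) := inferInstance
  refine hXN (ih _ htop S fun K hK hbot ↦ ?_)
  refine IsPNilpotent.normalizer_of_map N.subtype_injective ?_
  set e := (S : Subgroup N).equivMapOfInjective N.subtype N.subtype_injective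
  have hK' := Characteristic.map_equiv hK e
  have hKe := map_subtype_map_equiv (f := N.subtype) e (fun s ↦ rfl) K
  have hbot' : K.map e.toMonoidHom ≠ ⊥ := by
    rwa [Ne, map_eq_bot_iff_of_injective _ e.injective]
  rw [← hKe]
  obtain ⟨Q, hQ⟩ := (S.2.map N.subtype).exists_le_sylow
  obtain hSQ | hSQ := hQ.eq_or_lt
  · have hQ' := hP.sylow Q
    rw [← hSQ] at hQ'
    exact hQ' _ hK' hbot'
  · by_contra hnot
    have hlt := lt_normalizer_inf Q.2 hSQ
    set W := (K.map e.toMonoidHom).map (map N.subtype S).subtype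
    have hWp : IsPGroup p W := (S.2.map N.subtype).to_le (map_subtype_le _)
    have hW : W ∈ s := ⟨hWp, by rwa [Ne, map_eq_bot_iff_of_injective _ (subtype_injective _)], hnot⟩
    suffices hf : (Nat.card N).factorization p < (Nat.card (normalizer (W : Set G))).factorization p
      from (hmax hW hf.le).not_gt hf
    have hDW : normalizer (map N.subtype S : Set G) ⊓ Q ≤ normalizer (W : Set G) :=
      inf_le_left.trans (normalizer_le_normalizer_map_of_characteristic hK')
    obtain ⟨k, hk⟩ := IsPGroup.iff_card.1 (Q.2.to_le (inf_le_right :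
      normalizer (map N.subtype S : Set G) ⊓ Q ≤ Q))
    have hcard := Set.Finite.card_lt_card (Set.toFinite _) hlt
    rw [SetLike.coe_sort_coe, SetLike.coe_sort_coe, hk, card_map_of_injective N.subtype_injective,
      S.card_eq_multiplicity, Nat.pow_lt_pow_iff_right (Fact.out : p.Prime).one_lt] at hcard
    refine hcard.trans_le
      (((Fact.out : p.Prime).pow_dvd_iff_le_factorization Nat.card_pos.ne').1 ?_)
    rw [← hk]
    exact card_dvd_of_le hDW

end CharacteristicNormalizers

section Quotient

open Subgroup
open scoped Pointwise

variable {p : ℕ} {G : Type*} [Group G]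

/-- A version of the Frattini argument. -/
lemma exists_mul_mem_normalizer [Finite G] [Fact p.Prime] {K A : Subgroup G} (hK : IsPGroup p K)
    (hKA : K ≤ A) (hindex : ¬ p ∣ K.relIndex A) {g : G} (hg : g ∈ normalizer (A : Set G)) :
    ∃ a ∈ A, a * g ∈ normalizer (K : Set G) := by
  have hgA : MulAut.conj g • A = A := (mem_normalizer_iff_map_conj_eq.1 hg)
  have hindex' : ¬ p ∣ (MulAut.conj g • K).relIndex A := by
    rwa [← hgA, relIndex_pointwise_smul]
  obtain ⟨a, ha⟩ := MulAction.exists_smul_eq A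
    (((hK.map (MulAut.conj g).toMonoidHom).comap_of_injective A.subtype
      A.subtype_injective).toSylow hindex')
    ((hK.comap_of_injective A.subtype A.subtype_injective).toSylow hindex)
  have hmem : ∀ y ∈ A, y ∈ K ↔ (a * g : G)⁻¹ * y * (a * g) ∈ K := by
    intro y hy
    have h1 := SetLike.ext_iff.1 ha ⟨y, hy⟩
    have h2 : (⟨y, hy⟩ : A) ∈ ((K.subgroupOf A) : Subgroup A) ↔ _ := h1.symm
    rw [mem_subgroupOf] at h2
    refine h2.trans ((mem_pointwise_smul_iff_inv_smul_mem).trans ?_)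
    refine (mem_pointwise_smul_iff_inv_smul_mem (a := MulAut.conj g) (S := K)).trans ?_
    simp [mul_assoc]
  have hag : ∀ y : G, y ∈ A ↔ (a * g : G)⁻¹ * y * (a * g) ∈ A :=
    mem_normalizer_iff''.1 (mul_mem (le_normalizer a.2) hg)
  refine ⟨a, a.2, mem_normalizer_iff''.2 fun y ↦ ⟨fun hy ↦ (hmem y (hKA hy)).1 hy, fun hy ↦ ?_⟩⟩
  exact (hmem y ((hag y).2 (hKA hy))).2 hy

lemma relIndex_sup_dvd_card [Finite G] (M N : Subgroup G) [N.Normal] :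
    M.relIndex (M ⊔ N) ∣ Nat.card N := by
  have h1 : Nat.card N * N.relIndex M = Nat.card M * M.relIndex (M ⊔ N) := by
    rw [← relIndex_sup_right M N, ← relIndex_bot_left, ← relIndex_bot_left,
      relIndex_mul_relIndex _ _ _ bot_le le_sup_left,
      relIndex_mul_relIndex _ _ _ bot_le le_sup_right]
  obtain ⟨t, ht⟩ := N.relIndex_dvd_card M
  rw [ht, mul_comm, mul_assoc] at h1
  have h0 : 0 < N.relIndex M := Nat.pos_of_ne_zero fun h0 ↦ by
    rw [h0, zero_mul] at ht
    exact Nat.card_pos.ne' ht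
  rw [Nat.eq_of_mul_eq_mul_left h0 h1]
  exact dvd_mul_left _ _

lemma HasPNilpotentNormalizers.quotient [Finite G] [Fact p.Prime] {P N : Subgroup G} [N.Normal]
    (hPp : IsPGroup p P) (hN : (Nat.card N).Coprime p) (h : HasPNilpotentNormalizers p P) :
    HasPNilpotentNormalizers p (P.map (QuotientGroup.mk' N)) := by
  intro K hK hbot
  have hinj : Function.Injective ((QuotientGroup.mk' N).subgroupMap P) := by
    refine (injective_iff_map_eq_one _).2 fun x hx ↦ ?_
    have hxN : (x : G) ∈ N := (QuotientGroup.eq_one_iff (x : G)).1 (congrArg Subtype.val hx)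
    have hPN : P ⊓ N = ⊥ := eq_bot_of_isPGroup_of_coprime (hPp.to_le inf_le_left)
      (hN.coprime_dvd_left (card_dvd_of_le inf_le_right))
    exact Subtype.ext (mem_bot.1 (hPN ▸ mem_inf.2 ⟨x.2, hxN⟩))
  let e : P ≃* P.map (QuotientGroup.mk' N) :=
    MulEquiv.ofBijective _ ⟨hinj, (QuotientGroup.mk' N).subgroupMap_surjective P⟩
  set L := K.map e.symm.toMonoidHom with hL
  have hLK : L.map e.toMonoidHom = K := by
    rw [hL, map_map]
    convert K.map_id
    ext x
    simp
  have hKL := map_subtype_map_equiv (f := QuotientGroup.mk' N) e (fun s ↦ rfl) L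
  rw [hLK] at hKL
  rw [hKL]
  have hnil := h L (Characteristic.map_equiv hK e.symm)
    (by rwa [Ne, map_eq_bot_iff_of_injective _ e.symm.injective])
  generalize hM : L.map P.subtype = M at *
  have hMP : M ≤ P := hM ▸ map_subtype_le _
  refine hnil.of_surjective
    (f := ((QuotientGroup.mk' N).comp (normalizer (M : Set G)).subtype).codRestrict
    (normalizer (M.map (QuotientGroup.mk' N) : Set (G ⧸ N)))
    fun x ↦ le_normalizer_map _ (mem_map_of_mem _ x.2)) ?_
  rintro ⟨x, hx⟩
  obtain ⟨g, rfl⟩ := QuotientGroup.mk'_surjective N x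
  have hg : g ∈ normalizer ((M ⊔ N : Subgroup G) : Set G) := by
    rw [← QuotientGroup.ker_mk' N, ← comap_map_eq]
    exact le_normalizer_comap _ hx
  have hindex : ¬ p ∣ M.relIndex (M ⊔ N) := fun hp ↦
    (Fact.out : p.Prime).coprime_iff_not_dvd.1 hN.symm
      (hp.trans (relIndex_sup_dvd_card M N))
  obtain ⟨a, ha, hag⟩ := exists_mul_mem_normalizer (hPp.to_le hMP) le_sup_left hindex hg
  rw [← SetLike.mem_coe, mul_normal] at ha
  obtain ⟨m, hm, n, hn, rfl⟩ := ha
  refine ⟨⟨m⁻¹ * (m * n * g), mul_mem (inv_mem (le_normalizer hm)) hag⟩, Subtype.ext ?_⟩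
  refine (QuotientGroup.eq (s := N)).2 ?_
  simpa [mul_assoc] using ‹N.Normal›.conj_mem _ (inv_mem hn) g⁻¹

end Quotient

section Structure

open Subgroup

variable {p : ℕ} {G : Type*} [Group G]

lemma IsPNilpotent.of_sylow_le_center [Finite G] [Fact p.Prime] (P : Sylow p G)
    (h : (P : Subgroup G) ≤ center G) : IsPNilpotent p G := by
  have hP : normalizer (P : Set G) ≤ centralizer (P : Set G) := fun g _ ↦
    mem_centralizer_iff.2 fun x hx ↦ (mem_center_iff.1 (h hx) g).symm
  refine ⟨(MonoidHom.transferSylow P hP).ker, inferInstance, ?_, fun g ↦ ?_⟩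
  · rw [Nat.coprime_comm, (Fact.out : p.Prime).coprime_iff_not_dvd]
    exact MonoidHom.not_dvd_card_ker_transferSylow P hP
  · obtain ⟨k, hk⟩ := isPGroup_iff_pow_pow_eq_one.1 P.2 (MonoidHom.transferSylow P hP g)
    exact ⟨k, by rwa [MonoidHom.mem_ker, map_pow]⟩

/-- If `H` is the largest normal `p`-subgroup and there is no nontrivial normal subgroup of order
prime to `p`, then `H` contains its centralizer provided that `G ⧸ H` is `p`-nilpotent. -/
lemma centralizer_le_of_isPNilpotent_quotient [Finite G] [Fact p.Prime]
    (hcop : ∀ N : Subgroup G, N.Normal → (Nat.card N).Coprime p → N = ⊥) {H L : Subgroup G}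
    [H.Normal] [L.Normal] (hH : IsPGroup p H)
    (hHmax : ∀ X : Subgroup G, X.Normal → IsPGroup p X → X ≤ H)
    (hLc : (Nat.card (L.map (QuotientGroup.mk' H))).Coprime p)
    (hL : ∀ g : G, ∃ k, g ^ p ^ k ∈ L) : centralizer (H : Set G) ≤ H := by
  set D := centralizer (H : Set G) ⊓ L with hD
  have hindex : ¬ p ∣ (H.subgroupOf D).index := by
    have h1 : H.relIndex D = Nat.card (D.map (QuotientGroup.mk' H)) := by
      rw [← relIndex_ker, QuotientGroup.ker_mk']
    change ¬ p ∣ H.relIndex D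
    rw [h1, ← (Fact.out : p.Prime).coprime_iff_not_dvd, Nat.coprime_comm]
    exact hLc.coprime_dvd_left (card_dvd_of_le (map_mono inf_le_right))
  have hDnil : IsPNilpotent p D := by
    refine IsPNilpotent.of_sylow_le_center
      ((hH.comap_of_injective D.subtype D.subtype_injective).toSylow hindex) fun x hx ↦ ?_
    exact mem_center_iff.2 fun y ↦ Subtype.ext (mem_centralizer_iff.1 y.2.1 x hx).symm
  obtain ⟨N, hN, -, hc, hk⟩ := hDnil.exists_normal
  rw [hcop N hN hc] at hk
  refine hHmax _ inferInstance (isPGroup_iff_pow_pow_eq_one.2 fun g ↦ ?_)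
  obtain ⟨k, hgk⟩ := hL g
  obtain ⟨l, hl⟩ := hk _ ⟨pow_mem g.2 _, hgk⟩
  exact ⟨k + l, Subtype.ext (by simpa [pow_add, pow_mul] using hl)⟩

/-- If all proper subgroups containing `P` are `p`-nilpotent, and some normal `p`-subgroup
contains its centralizer, then `P` is a maximal subgroup. -/
lemma isCoatom_of_centralizer_le [Finite G] [Fact p.Prime] {P : Sylow p G}
    (hmax : ∀ K : Subgroup G, (P : Subgroup G) ≤ K → K ≠ ⊤ → IsPNilpotent p K)
    (hG : ¬ IsPNilpotent p G) {H : Subgroup G} [H.Normal] (hH : IsPGroup p H)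
    (hC : centralizer (H : Set G) ≤ H) : IsCoatom (P : Subgroup G) := by
  constructor
  · intro h
    refine hG (IsPNilpotent.of_isPGroup ?_)
    exact P.2.of_surjective (P : Subgroup G).subtype fun x ↦ ⟨⟨x, h ▸ mem_top x⟩, rfl⟩
  · intro K hPK
    by_contra htop
    refine hPK.ne (P.3 ?_ hPK.le).symm
    obtain ⟨N, hN, hc, hk⟩ := hmax K hPK.le htop
    have hHK : H ≤ K := (hH.le_sylow_of_normal P).trans hPK.le
    have hNH : N ≤ H.subgroupOf K := fun x hx ↦ hC <| mem_centralizer_iff.2 fun y hy ↦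
      congrArg Subtype.val (commute_of_isPGroup_of_coprime (p := p) (X := H.subgroupOf K)
        inferInstance hN (hH.comap_of_injective _ (subtype_injective _)) hc
        (x := ⟨y, hHK hy⟩) hy hx).eq
    have hbot := eq_bot_of_isPGroup_of_coprime
      ((hH.comap_of_injective _ (subtype_injective _)).to_le hNH) hc
    refine isPGroup_iff_pow_pow_eq_one.2 fun g ↦ ?_
    obtain ⟨k, hk⟩ := hk g
    exact ⟨k, by simpa [hbot] using hk⟩

/-- A normal subgroup of order prime to `p` is abelian if a Sylow `p`-subgroup is maximal. -/
lemma commutator_eq_bot_of_isCoatom [Finite G] [Fact p.Prime] {P : Sylow p G}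
    (hP : IsCoatom (P : Subgroup G)) {L : Subgroup G} [L.Normal] (hL : (Nat.card L).Coprime p) :
    ⁅L, L⁆ = ⊥ := by
  have hPL : (P : Subgroup G) ⊓ L = ⊥ := eq_bot_of_isPGroup_of_coprime (P.2.to_le inf_le_left)
    (hL.coprime_dvd_left (card_dvd_of_le inf_le_right))
  by_cases hbot : L = ⊥
  · rw [hbot, commutator_bot_left]
  have hnil : Group.IsNilpotent L := by
    refine isNilpotent_of_isCoatom_of_supplement hP hPL fun T hT ↦ ?_
    obtain ⟨S⟩ : Nonempty (Sylow p T) := inferInstance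
    have hindex : ¬ p ∣ (map T.subtype S).index := by
      rw [index_map_subtype, (Fact.out : p.Prime).dvd_mul, not_or]
      refine ⟨S.not_dvd_index, fun h ↦ (Fact.out : p.Prime).coprime_iff_not_dvd.1 hL.symm ?_⟩
      have := relIndex_sup_dvd_card T L
      rw [hT, relIndex_top_right] at this
      exact h.trans this
    obtain ⟨g, hg⟩ := MulAction.exists_smul_eq G P ((S.2.map T.subtype).toSylow hindex)
    refine ⟨g, ?_⟩
    have : (P : Subgroup G).map (MulAut.conj g).toMonoidHom = map T.subtype S :=
      congrArg (fun Q : Sylow p G ↦ (Q : Subgroup G)) hg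
    rw [this]
    exact map_subtype_le _
  have hlt : ⁅L, L⁆ < L := by
    have : Nontrivial L := (nontrivial_iff_ne_bot _).2 hbot
    rw [← map_subtype_commutator]
    refine lt_of_le_of_ne (map_subtype_le _) fun h ↦ ?_
    refine (Group.IsSolvable.commutator_lt_top_of_nontrivial L).ne (map_injective
      L.subtype_injective ?_)
    rw [h, ← MonoidHom.range_eq_map, range_subtype]
  have hsup : ⁅L, L⁆ ⊔ P = P := by
    refine (hP.le_iff.1 (le_sup_right : (P : Subgroup G) ≤ ⁅L, L⁆ ⊔ P)).resolve_left fun h ↦ ?_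
    refine hlt.ne ?_
    refine le_antisymm hlt.le fun x hx ↦ ?_
    have hx' : x ∈ ⁅L, L⁆ ⊔ P := h ▸ mem_top x
    rw [← SetLike.mem_coe, normal_mul] at hx'
    obtain ⟨c, hc, g, hg, rfl⟩ := hx'
    have hg' : g ∈ (P : Subgroup G) ⊓ L := ⟨hg, (mul_mem_cancel_left (hlt.le hc)).1 hx⟩
    rw [hPL, mem_bot] at hg'
    simpa [hg'] using hc
  rw [eq_bot_iff, ← hPL]
  exact le_inf (sup_eq_right.1 hsup) hlt.le

end Structure

section NormalComplement

open Subgroup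
open scoped commutatorElement

variable {p : ℕ} {G : Type*} [Group G]

lemma HasPNilpotentNormalizers.quotient_of_isPGroup [Finite G] [Fact p.Prime] {P : Sylow p G}
    (hmax : ∀ K : Subgroup G, (P : Subgroup G) ≤ K → K ≠ ⊤ → IsPNilpotent p K)
    {H : Subgroup G} [H.Normal] (hH : IsPGroup p H)
    (hHmax : ∀ X : Subgroup G, X.Normal → IsPGroup p X → X ≤ H) :
    HasPNilpotentNormalizers p ((P : Subgroup G).map (QuotientGroup.mk' H)) := by
  intro K hK hbot
  have hn := normalizer_le_normalizer_map_of_characteristic hK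
  have hle := map_subtype_le K
  have hne : K.map (map (QuotientGroup.mk' H) P).subtype ≠ ⊥ := by
    rwa [Ne, map_eq_bot_iff_of_injective _ (subtype_injective _)]
  generalize K.map (map (QuotientGroup.mk' H) P).subtype = M at hn hle hne
  have hHP : H ≤ P := hH.le_sylow_of_normal P
  have hcomap : (normalizer (M : Set (G ⧸ H))).comap (QuotientGroup.mk' H) =
      normalizer (M.comap (QuotientGroup.mk' H) : Set G) :=
    comap_normalizer_eq_of_surjective _ (QuotientGroup.mk'_surjective H)
  have hPN : (P : Subgroup G) ≤ normalizer (M.comap (QuotientGroup.mk' H) : Set G) := by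
    rw [← hcomap, ← map_le_iff_le_comap]
    exact le_normalizer.trans hn
  have hMP : M.comap (QuotientGroup.mk' H) ≤ P := by
    refine (comap_mono hle).trans ?_
    rw [comap_map_eq, QuotientGroup.ker_mk', sup_eq_left.2 hHP]
  have hnil : IsPNilpotent p (normalizer (M.comap (QuotientGroup.mk' H) : Set G)) := by
    refine hmax _ hPN fun htop ↦ hne ?_
    have := hHmax _ (normalizer_eq_top_iff.1 htop) (P.2.to_le hMP)
    rw [eq_bot_iff, ← map_comap_eq_self_of_surjective (QuotientGroup.mk'_surjective H) M]
    refine (map_mono this).trans ?_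
    rw [map_le_iff_le_comap, MonoidHom.comap_bot, QuotientGroup.ker_mk']
  rw [← hcomap] at hnil
  exact hnil.of_surjective (MonoidHom.subgroupComap_surjective_of_surjective _ _
    (QuotientGroup.mk'_surjective H))

/-- Elements of a maximal Sylow subgroup centralizing a supplement modulo the largest normal
`p`-subgroup `H` lie in `H`. -/
lemma mem_of_forall_commutator_mem [Finite G] [Fact p.Prime] {P : Sylow p G}
    {H L : Subgroup G} [H.Normal] [L.Normal] (hH : IsPGroup p H)
    (hHmax : ∀ X : Subgroup G, X.Normal → IsPGroup p X → X ≤ H) (hLP : L ⊔ P = ⊤) {a : G}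
    (haP : a ∈ P) (ha : ∀ x ∈ L, ⁅x, a⁆ ∈ H) : a ∈ H := by
  set π := QuotientGroup.mk' H
  have hHP : H ≤ P := hH.le_sylow_of_normal P
  let Z : Subgroup G := P ⊓ (centralizer (L.map π : Set (G ⧸ H))).comap π
  have hmem : ∀ z, z ∈ (centralizer (L.map π : Set (G ⧸ H))).comap π ↔ ∀ x ∈ L, ⁅x, z⁆ ∈ H := by
    intro z
    rw [mem_comap, mem_centralizer_iff]
    simp only [coe_map, Set.forall_mem_image, SetLike.mem_coe, ← QuotientGroup.ker_mk' H,
      MonoidHom.mem_ker, map_commutatorElement, commutatorElement_eq_one_iff_mul_comm]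
    rfl
  have : (L.map π).Normal := ‹L.Normal›.map π (QuotientGroup.mk'_surjective H)
  have hC : ((centralizer (L.map π : Set (G ⧸ H))).comap π).Normal := inferInstance
  have hZ : Z.Normal := by
    rw [← normalizer_eq_top_iff, eq_top_iff, ← hLP]
    refine sup_le ?_ ?_
    · refine le_normalizer_iff.2 fun x hx z hz ↦ ⟨?_, hC.conj_mem z hz.2 x⟩
      have := mul_mem (hHP ((hmem z).1 hz.2 x hx)) hz.1
      rwa [commutatorElement_def, inv_mul_cancel_right] at this
    · exact le_normalizer_iff.2 fun x hx z hz ↦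
        ⟨(P : Subgroup G).mul_mem (mul_mem hx hz.1) ((P : Subgroup G).inv_mem hx),
          hC.conj_mem z hz.2 x⟩
  exact hHmax Z hZ (P.2.to_le inf_le_left) ⟨haP, (hmem a).2 ha⟩

end NormalComplement

section Quadratic

open Subgroup
open scoped commutatorElement IsMulCommutative

variable {p : ℕ} {G : Type*} [Group G]

/-- Elements of `P` acting quadratically on the centralizer of the largest normal `p`-subgroup `H`
lie in `H`, provided that `G ⧸ H` has an abelian normal `p`-complement. -/
lemma mem_of_quadratic [Finite G] [Fact p.Prime] (hodd : Odd p) {P : Sylow p G}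
    {H L : Subgroup G} [H.Normal] [L.Normal] (hH : IsPGroup p H)
    (hHmax : ∀ X : Subgroup G, X.Normal → IsPGroup p X → X ≤ H) (hLP : L ⊔ P = ⊤)
    (hLc : (Nat.card (L.map (QuotientGroup.mk' H))).Coprime p) (hL : ⁅L, L⁆ ≤ H)
    (hY : centralizer (H : Set G) ≤ H)
    (hCY : centralizer (centralizer (H : Set G) : Set G) ≤ H) {a : G} (haP : a ∈ P)
    (ha : ∀ v ∈ centralizer (H : Set G), ⁅a, ⁅a, v⁆⁆ = 1) : a ∈ H := by
  set Y := centralizer (H : Set G)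
  have hYn : Y.Normal := inferInstance
  have hHY : H ≤ centralizer (Y : Set G) := le_centralizer_iff.1 le_rfl
  have hYc : IsMulCommutative Y := ⟨⟨fun u v ↦
    Subtype.ext (mem_centralizer_iff.1 v.2 u (hY u.2))⟩⟩
  obtain ⟨k, hk⟩ := IsPGroup.iff_card.1 (hH.to_le hY)
  refine mem_of_forall_commutator_mem hH hHmax hLP haP fun x hx ↦ ?_
  have h1 : a⁻¹ * (x * a * x⁻¹) ∈ L := by
    have := mul_mem (Normal.conj_mem ‹L.Normal› x hx a⁻¹) (inv_mem hx)
    simpa [mul_assoc] using this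
  have h2 : x * a * x⁻¹ * a⁻¹ ∈ L := by
    have := mul_mem hx (Normal.conj_mem ‹L.Normal› _ (inv_mem hx) a)
    simpa [mul_assoc] using this
  have key : a⁻¹ * (x * a * x⁻¹) ∈ centralizer (Y : Set G) := by
    refine inv_mul_mem_centralizer_of_quadratic
      (m := Nat.card (L.map (QuotientGroup.mk' H))) (hk ▸ hodd.pow) ha (fun v hv ↦ ?_)
      (hHY (hL (commutator_mem_commutator h1 h2))) (hk ▸ hLc.pow_right k) (hHY ?_)
    · have := congrArg (fun g ↦ x * g * x⁻¹) (ha _ (hYn.conj_mem v hv x⁻¹))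
      simpa [commutatorElement_def, mul_assoc] using this
    · rw [← QuotientGroup.eq_one_iff, QuotientGroup.mk_pow]
      exact congrArg Subtype.val (pow_card_eq_one' (x := (⟨_, mem_map_of_mem _ h1⟩ :
        L.map (QuotientGroup.mk' H))))
  have := Normal.conj_mem ‹H.Normal› _ (hCY key) a
  simpa [commutatorElement_def, mul_assoc] using this

/-- Abelian subgroups of `P` normalized by `Y` act quadratically on `Y`. -/
lemma commutator_commutator_eq_one {A Y : Subgroup G} (hA : A ≤ centralizer (A : Set G))
    (hY : Y ≤ normalizer (A : Set G)) {a v : G} (ha : a ∈ A) (hv : v ∈ Y) : ⁅a, ⁅a, v⁆⁆ = 1 := by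
  have h : ⁅a, v⁆ ∈ A := by
    have := mul_mem ha ((mem_normalizer_iff.1 (hY hv) _).1 (inv_mem ha))
    simpa [commutatorElement_def, mul_assoc] using this
  exact commutatorElement_eq_one_iff_mul_comm.2 (mem_centralizer_iff.1 (hA h) a ha)

/-- A finite group with a maximal Sylow `p`-subgroup `P` (`p` odd) satisfying the following
conditions is `p`-nilpotent. -/
lemma isPNilpotent_of_isCoatom [Finite G] [Fact p.Prime] (hodd : Odd p) {P : Sylow p G}
    (hP : HasPNilpotentNormalizers p (P : Subgroup G)) (hPmax : IsCoatom (P : Subgroup G))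
    {H L : Subgroup G} [H.Normal] [L.Normal] (hH : IsPGroup p H) (hbot : H ≠ ⊥)
    (hHmax : ∀ X : Subgroup G, X.Normal → IsPGroup p X → X ≤ H) (hLP : L ⊔ P = ⊤)
    (hLc : (Nat.card (L.map (QuotientGroup.mk' H))).Coprime p) (hL : ⁅L, L⁆ ≤ H)
    (hY : centralizer (H : Set G) ≤ H) : IsPNilpotent p G := by
  by_contra hG
  have hHP : H ≤ P := hH.le_sylow_of_normal P
  have hYn : (centralizer (H : Set G)).Normal := inferInstance
  have hchar : ∀ K : Subgroup P, K.Characteristic → K ≠ ⊥ →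
      normalizer (K.map (P : Subgroup G).subtype : Set G) ≠ ⊤ := by
    intro K hK hK' h
    have := hP K hK hK'
    rw [h] at this
    exact hG (this.of_surjective (f := (⊤ : Subgroup G).subtype) fun x ↦ ⟨⟨x, mem_top x⟩, rfl⟩)
  have hnt : Nontrivial P := (nontrivial_iff_ne_bot _).2 fun h ↦ hbot (eq_bot_iff.2 (h ▸ hHP))
  have hcenter : center P ≠ ⊥ := (nontrivial_iff_ne_bot _).1 P.2.center_nontrivial
  have hZ : (center P).map (P : Subgroup G).subtype ≤ centralizer (H : Set G) := by
    rintro _ ⟨z, hz, rfl⟩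
    exact mem_centralizer_iff.2 fun h hh ↦
      congrArg Subtype.val (mem_center_iff.1 hz ⟨h, hHP hh⟩)
  have hCY : centralizer (centralizer (H : Set G) : Set G) ≤ H := by
    refine hHmax _ inferInstance (P.2.to_le ?_)
    have h1 : (P : Subgroup G) ≤ normalizer ((center P).map (P : Subgroup G).subtype : Set G) :=
      le_normalizer.trans (normalizer_le_normalizer_map_of_characteristic inferInstance)
    have h2 := (hPmax.le_iff.1 h1).resolve_left (hchar _ inferInstance hcenter)
    rw [← h2]
    exact (centralizer_le hZ).trans (centralizer_le_normalizer _)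
  have hYE : centralizer (H : Set G) ≤ puigEven (P : Subgroup G) := by
    refine le_puigEven (hY.trans hHP) (centralizer_le hY) ?_
    rw [normalizer_eq_top_iff.2 hYn]
    exact le_top
  have hPuig : puigOdd (P : Subgroup G) ≤ H := puig_le_iff.2 fun A hAP hA hEA a ha ↦
    mem_of_quadratic hodd hH hHmax hLP hLc hL hY hCY (hAP ha) fun v hv ↦
      commutator_commutator_eq_one hA (hYE.trans hEA) ha hv
  have hE : (puigEven (⊤ : Subgroup P)).map (P : Subgroup G).subtype =
      puigEven (P : Subgroup G) := by
    rw [map_puigEven (subtype_injective _), ← MonoidHom.range_eq_map, range_subtype]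
  refine hchar (puigEven ⊤) inferInstance (fun h ↦ hcenter ?_) ?_
  · rw [h, Subgroup.map_bot] at hE
    rw [← map_eq_bot_iff_of_injective _ (subtype_injective (P : Subgroup G)), eq_bot_iff, hE]
    exact hZ.trans hYE
  · rw [hE, ← puigEven_eq_of_puigOdd_le hPuig hHP, normalizer_eq_top_iff]
    exact puigEven_normal inferInstance

end Quadratic

section NormalComplement

open Subgroup

variable {p : ℕ} {G : Type*} [Group G]

lemma isCoatom_map_of_ker_le {G' : Type*} [Group G'] {f : G →* G'} (hf : Function.Surjective f)
    {M : Subgroup G} (hker : f.ker ≤ M) (hM : IsCoatom M) : IsCoatom (M.map f) := by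
  have hcomap : (M.map f).comap f = M := by rw [comap_map_eq, sup_eq_left.2 hker]
  refine ⟨fun h ↦ hM.1 (by rw [← hcomap, h, comap_top]), fun K hK ↦ ?_⟩
  rw [← comap_injective hf |>.eq_iff, comap_top]
  refine hM.2 _ ?_
  rw [← hcomap]
  exact (comap_lt_comap_of_surjective hf).2 hK

/-- **Normal `p`-complement theorem**: if `p` is odd and every nontrivial characteristic subgroup
of a Sylow `p`-subgroup has a `p`-nilpotent normalizer, then the group is `p`-nilpotent. -/
theorem HasPNilpotentNormalizers.isPNilpotent [Fact p.Prime] (hodd : Odd p) {G : Type u} [Group G]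
    [Finite G] {P : Sylow p G} (hP : HasPNilpotentNormalizers p (P : Subgroup G)) :
    IsPNilpotent p G := by
  induction hn : Nat.card G using Nat.strong_induction_on generalizing G with
  | _ n ih =>
  subst hn
  by_contra hG
  have ih' : ∀ N : Subgroup G, N ≠ ⊤ → ∀ S : Sylow p N,
      HasPNilpotentNormalizers p (S : Subgroup N) → IsPNilpotent p N := fun N hN S hS ↦
    ih _ (lt_of_le_of_ne (card_le_card_group N) fun h ↦ hN (eq_top_of_card_eq N h)) hS rfl
  have ihq : ∀ N : Subgroup G, ∀ _ : N.Normal, N ≠ ⊥ →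
      HasPNilpotentNormalizers p ((P : Subgroup G).map (QuotientGroup.mk' N)) →
      IsPNilpotent p (G ⧸ N) := by
    intro N _ hN h
    refine ih _ ?_ (P := P.mapSurjective (QuotientGroup.mk'_surjective N)) h rfl
    rw [card_eq_card_quotient_mul_card_subgroup N]
    exact lt_mul_of_one_lt_right Nat.card_pos ((one_lt_card_iff_ne_bot N).2 hN)
  obtain ⟨X, hXn, hXp, hX⟩ := exists_normal_isPGroup_of_not_isPNilpotent hP ih' hG
  have hcop : ∀ N : Subgroup G, N.Normal → (Nat.card N).Coprime p → N = ⊥ := by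
    intro N hN hc
    by_contra hbot
    exact hG (IsPNilpotent.of_quotient hc (ihq N hN hbot (hP.quotient P.2 hc)))
  have hmax : ∀ K : Subgroup G, (P : Subgroup G) ≤ K → K ≠ ⊤ → IsPNilpotent p K := by
    intro K hPK hK
    refine ih' K hK (P.subtype hPK) (HasPNilpotentNormalizers.of_map K.subtype_injective ?_)
    rw [Sylow.coe_subtype, map_subgroupOf_eq_of_le hPK]
    exact hP
  set H : Subgroup G := sSup {X | X.Normal ∧ IsPGroup p X}
  have hHmax : ∀ X : Subgroup G, X.Normal → IsPGroup p X → X ≤ H := fun X h1 h2 ↦ le_sSup ⟨h1, h2⟩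
  have hHn : H.Normal := sSup_normal _ fun X hX ↦ hX.1
  have hH : IsPGroup p H := Sylow.sSup_of_normal _ (fun X hX ↦ hX.2) fun X hX ↦ hX.1
  have hbot : H ≠ ⊥ := fun h ↦ hX (eq_bot_iff.2 (h ▸ hHmax X hXn hXp))
  obtain ⟨N, hN, hNc, hNk⟩ := ihq H hHn hbot
    (HasPNilpotentNormalizers.quotient_of_isPGroup hmax hH hHmax)
  set L := N.comap (QuotientGroup.mk' H)
  have hLN : L.map (QuotientGroup.mk' H) = N :=
    map_comap_eq_self_of_surjective (QuotientGroup.mk'_surjective H) N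
  have hLc : (Nat.card (L.map (QuotientGroup.mk' H))).Coprime p := by rwa [hLN]
  have hLk : ∀ g, ∃ k, g ^ p ^ k ∈ L := fun g ↦ hNk (QuotientGroup.mk' H g)
  have hC := centralizer_le_of_isPNilpotent_quotient hcop hH hHmax hLc hLk
  have hPmax := isCoatom_of_centralizer_le hmax hG hH hC
  refine hG (isPNilpotent_of_isCoatom hodd hP hPmax hH hbot hHmax (sup_sylow_eq_top hLk P)
    hLc ?_ hC)
  have hP' : IsCoatom (P.mapSurjective (QuotientGroup.mk'_surjective H) : Subgroup (G ⧸ H)) :=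
    isCoatom_map_of_ker_le (QuotientGroup.mk'_surjective H)
      (by rw [QuotientGroup.ker_mk']; exact hH.le_sylow_of_normal P) hPmax
  have := commutator_eq_bot_of_isCoatom hP' hNc
  rwa [← hLN, ← map_commutator, Subgroup.map_eq_bot_iff, QuotientGroup.ker_mk'] at this

end NormalComplement

section NilpotentMaximal

open Subgroup

variable {p : ℕ} {G : Type*} [Group G] {M : Subgroup G}

lemma normalizer_eq_of_isCoatom (hM : IsCoatom M) (hcore : M.normalCore = ⊥) {K : Subgroup G}
    (hKM : K ≤ M) (hK : K ≠ ⊥) (hn : M ≤ normalizer (K : Set G)) : normalizer (K : Set G) = M := by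
  refine (hM.le_iff.1 hn).resolve_left fun h ↦ hK ?_
  have : K.Normal := normalizer_eq_top_iff.1 h
  exact eq_bot_iff.2 (hcore ▸ normal_le_normalCore.2 hKM)

/-- A nilpotent maximal subgroup with trivial core is the normalizer of a Sylow `p`-subgroup, for
each prime divisor `p` of its order. -/
lemma exists_sylow_normalizer_eq [Finite G] [Fact p.Prime] (hM : IsCoatom M)
    (hcore : M.normalCore = ⊥) [Group.IsNilpotent M] (hp : p ∣ Nat.card M) :
    ∃ Q : Sylow p G, (Q : Subgroup G) ≤ M ∧ normalizer ((Q : Subgroup G) : Set G) = M := by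
  obtain ⟨S⟩ : Nonempty (Sylow p M) := inferInstance
  have hSn : (S : Subgroup M).Normal := inferInstance
  have hS : normalizer (S.map M.subtype : Set G) = M := by
    refine normalizer_eq_of_isCoatom hM hcore (map_subtype_le _) ?_ ?_
    · rw [Ne, map_eq_bot_iff_of_injective _ M.subtype_injective]
      exact S.ne_bot_of_dvd_card hp
    · have := le_normalizer_map (H := (S : Subgroup M)) M.subtype
      rwa [normalizer_eq_top_iff.2 hSn, ← MonoidHom.range_eq_map, range_subtype] at this
  obtain ⟨Q, hQ⟩ := (S.2.map M.subtype).exists_le_sylow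
  have hSQ : S.map M.subtype = Q := by
    refine hQ.eq_or_lt.resolve_right fun hlt ↦ ?_
    have h1 := lt_normalizer_inf Q.2 hlt
    rw [hS] at h1
    have h2 : (Q : Subgroup G).subgroupOf M = S :=
      S.3 (Q.2.comap_of_injective M.subtype M.subtype_injective) (map_le_iff_le_comap.1 hQ)
    rw [← h2, subgroupOf_map_subtype, inf_comm] at h1
    exact h1.false
  exact ⟨Q, hSQ.ge.trans (map_subtype_le _), by rw [← hS, hSQ]⟩

lemma isPNilpotent_of_isCoatom_of_isNilpotent {G : Type u} [Group G] [Finite G] {M : Subgroup G}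
    [Fact p.Prime] (hM : IsCoatom M) (hcore : M.normalCore = ⊥) [hnil : Group.IsNilpotent M]
    (hp : p ∣ Nat.card M) (hodd : Odd p) : IsPNilpotent p G := by
  obtain ⟨Q, hQM, hQ⟩ := exists_sylow_normalizer_eq hM hcore hp
  refine HasPNilpotentNormalizers.isPNilpotent hodd (P := Q) fun K hK hbot ↦ ?_
  rw [normalizer_eq_of_isCoatom hM hcore ((map_subtype_le K).trans hQM)
    (by rwa [Ne, map_eq_bot_iff_of_injective _ (subtype_injective _)])
    (hQ.ge.trans (normalizer_le_normalizer_map_of_characteristic hK))]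
  exact IsPNilpotent.of_isNilpotent hnil

lemma isNilpotent_quotient_of_sup_eq_top [Group.IsNilpotent M] {L : Subgroup G} [L.Normal]
    (hML : M ⊔ L = ⊤) : Group.IsNilpotent (G ⧸ L) := by
  refine Group.nilpotent_of_surjective ((QuotientGroup.mk' L).comp M.subtype) ?_
  rw [← MonoidHom.range_eq_top, MonoidHom.range_comp, range_subtype]
  refine comap_injective (QuotientGroup.mk'_surjective L) ?_
  rw [comap_map_eq, QuotientGroup.ker_mk', hML, comap_top]

/-- A nontrivial nilpotent maximal subgroup with trivial core and with a normal complement `L` of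
coprime order is, up to conjugation, contained in every supplement of `L`. -/
lemma exists_map_conj_le_of_sup_eq_top [Finite G] (hM : IsCoatom M) (hcore : M.normalCore = ⊥)
    [Group.IsNilpotent M] (hbot : M ≠ ⊥) {L : Subgroup G} [L.Normal]
    (hc : (Nat.card L).Coprime (Nat.card M)) (hML : M ⊔ L = ⊤) {T : Subgroup G}
    (hT : T ⊔ L = ⊤) : ∃ g : G, M.map (MulAut.conj g).toMonoidHom ≤ T := by
  have hindex : ∀ K : Subgroup G, K ⊔ L = ⊤ → L.relIndex K = L.index := fun K hK ↦ by
    rw [← relIndex_sup_right, hK, relIndex_top_right]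
  have hdisj : ∀ K : Subgroup G, Nat.card K = Nat.card M → L ⊓ K = ⊥ := fun K hK ↦
    (disjoint_of_coprime_natCard (hK ▸ hc)).eq_bot
  have hLM : L.index = Nat.card M := by
    rw [← hindex M hML, ← inf_relIndex_right, hdisj M rfl, relIndex_bot_left]
  obtain ⟨C, hC⟩ := exists_right_complement'_of_coprime (N := L.subgroupOf T) (by
    change (Nat.card (L.subgroupOf T)).Coprime (L.relIndex T)
    rw [hindex T hT, hLM]
    exact hc.coprime_dvd_left (card_comap_dvd_of_injective L T.subtype T.subtype_injective))
  set M₁ := C.map T.subtype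
  have hM₁ : Nat.card M₁ = Nat.card M := by
    rw [card_map_of_injective T.subtype_injective, ← hC.symm.index_eq_card, ← hLM, ← hindex T hT]
    rfl
  have hquot := isNilpotent_quotient_of_sup_eq_top hML
  have hnil : Group.IsNilpotent M₁ := by
    refine Subgroup.isNilpotent_of_ker_le_center ((QuotientGroup.mk' L).comp M₁.subtype) ?_
    have : L.subgroupOf M₁ = ⊥ := subgroupOf_eq_bot.2 (disjoint_iff.2 (hdisj M₁ hM₁))
    rw [← MonoidHom.comap_ker, QuotientGroup.ker_mk']
    exact this.trans_le bot_le
  obtain ⟨p, hp, hpM⟩ := Nat.exists_prime_and_dvd ((one_lt_card_iff_ne_bot M).2 hbot).ne'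
  have : Fact p.Prime := ⟨hp⟩
  obtain ⟨Q, hQM, hQ⟩ := exists_sylow_normalizer_eq hM hcore hpM
  obtain ⟨S⟩ : Nonempty (Sylow p M₁) := inferInstance
  have hSn : (S : Subgroup M₁).Normal := inferInstance
  have hS : ¬ p ∣ (S.map M₁.subtype).index := by
    have h1 : M₁.index = M.index := by
      refine Nat.eq_of_mul_eq_mul_left (Nat.card_pos (α := M)) ?_
      rw [card_mul_index, ← hM₁, card_mul_index]
    rw [index_map_subtype, h1, hp.dvd_mul, not_or]
    exact ⟨S.not_dvd_index, fun h ↦ Q.not_dvd_index (h.trans (index_dvd_of_le hQM))⟩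
  obtain ⟨g, hg⟩ := MulAction.exists_smul_eq G Q ((S.2.map M₁.subtype).toSylow hS)
  have hg' : (Q : Subgroup G).map (MulAut.conj g).toMonoidHom = S.map M₁.subtype :=
    congrArg (fun R : Sylow p G ↦ (R : Subgroup G)) hg
  refine ⟨g, ?_⟩
  have hle : M₁ ≤ M.map (MulAut.conj g).toMonoidHom := by
    have h1 := le_normalizer_map (H := (S : Subgroup M₁)) M₁.subtype
    rw [normalizer_eq_top_iff.2 hSn, ← MonoidHom.range_eq_map, range_subtype, ← hg'] at h1
    rw [← hQ]
    refine h1.trans_eq ?_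
    exact (map_equiv_normalizer_eq (Q : Subgroup G) (MulAut.conj g)).symm
  rw [← eq_of_le_of_card_ge hle]
  · exact map_subtype_le C
  · rw [hM₁, card_map_of_injective (MulAut.conj g).injective]

lemma isSolvable_of_isCoatom_of_normalCore_eq_bot {G : Type u} [Group G] [Finite G]
    {M : Subgroup G} (hM : IsCoatom M) (hcore : M.normalCore = ⊥) [Group.IsNilpotent M]
    (hbot : M ≠ ⊥) (hodd : Odd (Nat.card M)) : Group.IsSolvable G := by
  let ι := (Nat.card M).primeFactors
  have hp : ∀ p : ι, Fact (p : ℕ).Prime := fun p ↦ ⟨Nat.prime_of_mem_primeFactors p.2⟩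
  have hpM : ∀ p : ι, (p : ℕ) ∣ Nat.card M := fun p ↦ Nat.dvd_of_mem_primeFactors p.2
  choose N hN hc hk using fun p : ι ↦
    isPNilpotent_of_isCoatom_of_isNilpotent hM hcore (hpM p) (hodd.of_dvd_nat (hpM p))
  have hq : ∀ p, Group.IsNilpotent (G ⧸ N p) := fun p ↦ (isPGroup_quotient (hk p)).isNilpotent
  set L : Subgroup G := ⨅ p, N p
  have hL : L.Normal := normal_iInf_normal hN
  have hLc : (Nat.card L).Coprime (Nat.card M) := by
    refine Nat.coprime_of_dvd fun q hq hqL hqM ↦ ?_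
    let p : ι := ⟨q, Nat.mem_primeFactors.2 ⟨hq, hqM, Nat.card_pos.ne'⟩⟩
    exact (hp p).out.coprime_iff_not_dvd.1 (hc p).symm
      (hqL.trans (card_dvd_of_le (iInf_le N p)))
  have hdisj : M ⊓ L = ⊥ := (disjoint_of_coprime_natCard hLc.symm).eq_bot
  obtain hML | hLM := hM.le_iff.1 (le_sup_left : M ≤ M ⊔ L)
  · have hLn : Group.IsNilpotent L := isNilpotent_of_isCoatom_of_supplement hM hdisj fun T hT ↦
      exists_map_conj_le_of_sup_eq_top hM hcore hbot hLc hML hT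
    have hquot := isNilpotent_quotient_of_sup_eq_top hML
    exact Group.isSolvable_of_ker_le_range L.subtype (QuotientGroup.mk' L) (by simp)
  · rw [inf_eq_right.2 (sup_eq_left.1 hLM)] at hdisj
    refine Group.isSolvable_of_isSolvable_injective
      (f := MonoidHom.pi fun p ↦ QuotientGroup.mk' (N p)) ?_
    rw [← MonoidHom.ker_eq_bot_iff, eq_bot_iff, ← hdisj]
    intro g hg
    exact mem_iInf.2 fun p ↦ (QuotientGroup.eq_one_iff g).1 (congrFun hg p)

/-- **Thompson's theorem**: a finite group with a nilpotent maximal subgroup of odd order is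
solvable. -/
theorem isSolvable_of_isCoatom_of_isNilpotent {G : Type u} [Group G] [Finite G] (M : Subgroup G)
    (hM : IsCoatom M) (hnil : Group.IsNilpotent M) (hodd : Odd (Nat.card M)) :
    Group.IsSolvable G := by
  induction hn : Nat.card G using Nat.strong_induction_on generalizing G with
  | _ n ih =>
  subst hn
  by_cases hcore : M.normalCore = ⊥
  · by_cases hbot : M = ⊥
    · subst hbot
      refine Group.isSolvable_of_comm fun a b ↦ ?_
      by_cases ha : a = 1
      · simp [ha]
      have htop : zpowers a = ⊤ := hM.2 _ (bot_lt_iff_ne_bot.2 (zpowers_ne_bot.2 ha))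
      obtain ⟨k, rfl⟩ := mem_zpowers_iff.1 (htop ▸ mem_top b : b ∈ zpowers a)
      exact (Commute.self_zpow a k).eq
    · exact isSolvable_of_isCoatom_of_normalCore_eq_bot hM hcore hbot hodd
  · set N := M.normalCore
    have hNM : N ≤ M := normalCore_le M
    have hmap : Function.Surjective ((QuotientGroup.mk' N).subgroupMap M) :=
      MonoidHom.subgroupMap_surjective _ _
    have hq : Group.IsSolvable (G ⧸ N) := by
      refine ih _ ?_ (M.map (QuotientGroup.mk' N))
        (isCoatom_map_of_ker_le (QuotientGroup.mk'_surjective N) ?_ hM)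
        (Group.nilpotent_of_surjective _ hmap)
        (hodd.of_dvd_nat (card_dvd_of_surjective _ hmap)) rfl
      · rw [card_eq_card_quotient_mul_card_subgroup N]
        exact lt_mul_of_one_lt_right Nat.card_pos ((one_lt_card_iff_ne_bot N).2 hcore)
      · rwa [QuotientGroup.ker_mk']
    have hN : Group.IsSolvable N :=
      Group.isSolvable_of_isSolvable_injective (inclusion_injective hNM)
    exact Group.isSolvable_of_ker_le_range N.subtype (QuotientGroup.mk' N) (by simp)

end NilpotentMaximal

theorem stmt19 {G : Type*} [Group G] [Fintype G]
    (M : Subgroup G) (hM : IsCoatom M) (hnil : Group.IsNilpotent ↥M)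
    (hodd : Odd (Nat.card ↥M)) :
    IsSolvable G := by
  exact isSolvable_of_isCoatom_of_isNilpotent M hM hnil hodd
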